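/- The torsion subgroup of the quotient of ℤ⁷ by the subgroup generated by the vectors (2,−1,−1,−1,−1,−1,−1), (0,0,0,0,0,1,−1), (0,0,0,0,1,−1,0), (0,0,0,1,−1,0,0), (0,0,1,−1,0,0,0) and (0,1,−1,0,0,0,0) is isomorphic to ℤ/2ℤ. (This is the singularity type A₅ + A₁.) -/

import Mathlib

theorem mem_L_iff (v : Fin 7 → ℤ) :
    v ∈ Submodule.span ℤ ({![2,-1,-1,-1,-1,-1,-1], ![0,0,0,0,0,1,-1], ![0,0,0,0,1,-1,0], ![0,0,0,1,-1,0,0], ![0,0,1,-1,0,0,0], ![0,1,-1,0,0,0,0]} : Set (Fin 7 → ℤ)) ↔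
      (2 ∣ v 0 ∧ 3 * v 0 + v 1 + v 2 + v 3 + v 4 + v 5 + v 6 = 0) := by
  constructor
  · intro h
    induction h using Submodule.span_induction with
    | mem x hx =>
      simp only [Set.mem_insert_iff, Set.mem_singleton_iff] at hx
      rcases hx with rfl | rfl | rfl | rfl | rfl | rfl <;> decide
    | zero => simp
    | add x y _ _ hx hy =>
      simp only [Pi.add_apply]
      omega
    | smul a x _ hx =>
      simp only [Pi.smul_apply, smul_eq_mul]
      refine ⟨hx.1.mul_left a, ?_⟩
      linear_combination a * hx.2
  · rintro ⟨⟨k, hk⟩, h⟩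
    simp only [Submodule.mem_span_insert, Submodule.mem_span_singleton]
    refine ⟨k, _, ⟨v 1 + v 2 + v 3 + v 4 + v 5 + 5 * k, _, ⟨v 1 + v 2 + v 3 + v 4 + 4 * k, _,
      ⟨v 1 + v 2 + v 3 + 3 * k, _, ⟨v 1 + v 2 + 2 * k, _, ⟨v 1 + k, rfl⟩, rfl⟩, rfl⟩, rfl⟩, rfl⟩, ?_⟩
    ext i
    fin_cases i <;> simp <;> omega

theorem quotient_torsion_eq :
    Nonempty
      ((AddCommGroup.torsion
        ((Fin 7 → ℤ) ⧸ Submodule.span ℤ ({![2,-1,-1,-1,-1,-1,-1], ![0,0,0,0,0,1,-1], ![0,0,0,0,1,-1,0], ![0,0,0,1,-1,0,0], ![0,0,1,-1,0,0,0], ![0,1,-1,0,0,0,0]} : Set (Fin 7 → ℤ)))) ≃+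
        ZMod 2) := by
  have key := mem_L_iff
  generalize Submodule.span ℤ ({![2,-1,-1,-1,-1,-1,-1], ![0,0,0,0,0,1,-1], ![0,0,0,0,1,-1,0], ![0,0,0,1,-1,0,0], ![0,0,1,-1,0,0,0], ![0,1,-1,0,0,0,0]} : Set (Fin 7 → ℤ)) = L at key ⊢
  let f : (Fin 7 → ℤ) →ₗ[ℤ] ZMod 2 :=
    ((Int.castAddHom (ZMod 2)).toIntLinearMap).comp (LinearMap.proj 0)
  have hf : ∀ v, f v = ((v 0 : ℤ) : ZMod 2) := fun v => rfl
  have hL : L ≤ LinearMap.ker f := by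
    intro v hv
    rw [LinearMap.mem_ker, hf]
    exact (ZMod.intCast_zmod_eq_zero_iff_dvd _ 2).2 ((key v).1 hv).1
  let g : AddCommGroup.torsion ((Fin 7 → ℤ) ⧸ L) →+ ZMod 2 :=
    (L.liftQ f hL).toAddMonoidHom.comp (AddCommGroup.torsion ((Fin 7 → ℤ) ⧸ L)).subtype
  refine ⟨AddEquiv.ofBijective g ⟨?_, ?_⟩⟩
  · rw [injective_iff_map_eq_zero]
    rintro ⟨x, hx⟩ h0
    obtain ⟨v, rfl⟩ := L.mkQ_surjective x
    have h0' : ((v 0 : ℤ) : ZMod 2) = 0 := h0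
    have h2 : (2 : ℤ) ∣ v 0 := (ZMod.intCast_zmod_eq_zero_iff_dvd _ 2).1 h0'
    have hx' : IsOfFinAddOrder (L.mkQ v) := hx
    obtain ⟨n, hn, hnv⟩ := isOfFinAddOrder_iff_nsmul_eq_zero.1 hx'
    rw [← map_nsmul, Submodule.mkQ_apply, Submodule.Quotient.mk_eq_zero, key] at hnv
    have h3 := hnv.2
    simp only [Pi.smul_apply, nsmul_eq_mul] at h3
    have h4 : (n : ℤ) * (3 * v 0 + v 1 + v 2 + v 3 + v 4 + v 5 + v 6) = 0 := by
      linear_combination h3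
    have h5 := (mul_eq_zero.1 h4).resolve_left (by exact_mod_cast hn.ne')
    apply Subtype.ext
    exact (Submodule.Quotient.mk_eq_zero L).2 ((key v).2 ⟨h2, h5⟩)
  · have ht : IsOfFinAddOrder (L.mkQ ![1,-3,0,0,0,0,0]) := by
      refine isOfFinAddOrder_iff_nsmul_eq_zero.2 ⟨2, by norm_num, ?_⟩
      rw [← map_nsmul, Submodule.mkQ_apply, Submodule.Quotient.mk_eq_zero, key]
      decide
    have h1 : g ⟨_, ht⟩ = 1 := by
      change (((![1,-3,0,0,0,0,0] : Fin 7 → ℤ) 0 : ℤ) : ZMod 2) = 1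
      simp
    intro y
    fin_cases y
    · exact ⟨0, map_zero g⟩
    · exact ⟨_, h1⟩
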